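/- arXiv:1804.02553 — 2 statements merged into one kernel-verified Lean document; each statement's English description precedes it below -/
import Mathlib

section
/- Let W → U be a surjective linear map of finite-dimensional vector spaces over a field K of characteristic zero, with kernel V, and n = dim U. For η ∈ Λ^n W*, define η̂ : S → Λ^n U* on the affine space S of linear sections σ of the projection by η̂(σ) = σ*(η). Then η̂ is an affine map if and only if η ∈ Λ^n_1 W*, where Λ^n_1 W* = {η ∈ Λ^n W* : ι_{v_2} ι_{v_1} η = 0 for all v_1, v_2 ∈ V}. Moreover this assignment gives a linear isomorphism Λ^n_1 W* ≅ Aff(S, Λ^n U*). -/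
/-- `F` is an affine map on the affine space `S` of linear sections of `π`
(characterized, over a field of characteristic zero, by being affine along
every line of sections). -/
def IsAffineOnSections {K W U T : Type*} [Field K]
    [AddCommGroup W] [Module K W] [AddCommGroup U] [Module K U]
    [AddCommGroup T] [Module K T]
    (π : W →ₗ[K] U) (F : (U →ₗ[K] W) → T) : Prop :=
  ∀ σ τ : U →ₗ[K] W, π.comp σ = LinearMap.id → π.comp τ = LinearMap.id →
    ∀ t : K, F (σ + t • (τ - σ)) = F σ + t • (F τ - F σ)

/-- `η` lies in `Λⁿ₁ W*`: it vanishes as soon as two of its arguments lie in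
`V = ker π`. -/
def InLambdaOne {K W U : Type*} [Field K]
    [AddCommGroup W] [Module K W] [AddCommGroup U] [Module K U]
    (π : W →ₗ[K] U) {n : ℕ} (η : W [⋀^Fin n]→ₗ[K] K) : Prop :=
  ∀ v : Fin n → W, (∃ i j, i ≠ j ∧ v i ∈ LinearMap.ker π ∧ v j ∈ LinearMap.ker π) →
    η v = 0

section Helpers

variable {K W U : Type*} [Field K]
    [AddCommGroup W] [Module K W] [AddCommGroup U] [Module K U]

/-- Additivity of affine maps along the model space. -/
lemma affine_add [CharZero K] {T : Type*} [AddCommGroup T] [Module K T]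
    {π : W →ₗ[K] U} {F : (U →ₗ[K] W) → T} (hF : IsAffineOnSections π F)
    {σ δ ε : U →ₗ[K] W} (hσ : π.comp σ = LinearMap.id) (hδ : π.comp δ = 0)
    (hε : π.comp ε = 0) : F (σ + δ + ε) + F σ = F (σ + δ) + F (σ + ε) := by
  have h1 := hF (σ + δ) (σ + ε) (by rw [LinearMap.comp_add, hσ, hδ, add_zero])
    (by rw [LinearMap.comp_add, hσ, hε, add_zero]) (2⁻¹ : K)
  have h2 := hF σ (σ + δ + ε) hσ
    (by rw [LinearMap.comp_add, LinearMap.comp_add, hσ, hδ, hε, add_zero, add_zero]) (2⁻¹ : K)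
  have h3 : σ + δ + (2⁻¹ : K) • (σ + ε - (σ + δ)) = σ + (2⁻¹ : K) • (σ + δ + ε - σ) := by
    module
  rw [h3, h2] at h1
  have h4 : (2 : K) • (F σ + (2⁻¹ : K) • (F (σ + δ + ε) - F σ)) = F (σ + δ + ε) + F σ := by
    module
  have h5 : (2 : K) • (F (σ + δ) + (2⁻¹ : K) • (F (σ + ε) - F (σ + δ)))
      = F (σ + δ) + F (σ + ε) := by
    module
  rw [← h4, ← h5, h1]

lemma affine_smul {T : Type*} [AddCommGroup T] [Module K T]
    {π : W →ₗ[K] U} {F : (U →ₗ[K] W) → T} (hF : IsAffineOnSections π F)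
    {σ δ : U →ₗ[K] W} (hσ : π.comp σ = LinearMap.id) (hδ : π.comp δ = 0) (t : K) :
    F (σ + t • δ) - F σ = t • (F (σ + δ) - F σ) := by
  have h1 := hF σ (σ + δ) hσ (by rw [LinearMap.comp_add, hσ, hδ, add_zero]) t
  rw [add_sub_cancel_left] at h1
  rw [h1, add_sub_cancel_left]

/-- Vanishing of a form with prescribed vertical entries can be tested on lifts of bases. -/
lemma vanish_of_basis {n : ℕ} (π : W →ₗ[K] U) (σ : U →ₗ[K] W) (hσ : π.comp σ = LinearMap.id)
    (e : Module.Basis (Fin n) K U) (η : W [⋀^Fin n]→ₗ[K] K) (s : Finset (Fin n))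
    (H : ∀ e' : Module.Basis (Fin n) K U, ∀ v : Fin n → W,
      (∀ k ∈ s, π (v k) = 0) → (∀ k, k ∉ s → π (v k) = e' k) → η v = 0)
    (v : Fin n → W) (hv : ∀ k ∈ s, π (v k) = 0) : η v = 0 := by
  classical
  have hσ' : ∀ u, π (σ u) = u := fun u => by
    simpa using LinearMap.congr_fun hσ u
  -- step 1
  have S1 : ∀ e' : Module.Basis (Fin n) K U, ∀ t : Finset (Fin n), ∀ v : Fin n → W,
      (∀ k ∈ s, π (v k) = 0) → (∀ k, k ∉ s → π (v k) = e' k ∨ (k ∈ t ∧ π (v k) = 0)) →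
      η v = 0 := by
    intro e' t
    induction t using Finset.induction_on with
    | empty =>
      intro v h1 h2
      exact H e' v h1 (fun k hk => by simpa using h2 k hk)
    | insert a t ha ih =>
      intro v h1 h2
      by_cases has : a ∈ s
      · refine ih v h1 (fun k hk => ?_)
        have hka : k ≠ a := fun h => hk (h ▸ has)
        simpa [hka] using h2 k hk
      rcases h2 a has with h3 | ⟨-, h3⟩
      · refine ih v h1 (fun k hk => ?_)
        by_cases hka : k = a
        · subst hka; exact Or.inl h3
        · simpa [hka] using h2 k hk
      have key : ∀ w : W, π w = e' a → η (Function.update v a w) = 0 := by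
        intro w hw
        refine ih _ (fun k hk => ?_) (fun k hk => ?_)
        · have hka : k ≠ a := fun h => has (h ▸ hk)
          simpa [hka] using h1 k hk
        · by_cases hka : k = a
          · subst hka; left; simpa using hw
          · simpa [hka] using h2 k hk
      have e1 := key (v a + σ (e' a)) (by rw [map_add, h3, hσ', zero_add])
      rw [AlternatingMap.map_update_add, key _ (hσ' _), add_zero, Function.update_eq_self] at e1
      exact e1
  -- step 2
  have S2 : ∀ t : Finset (Fin n), ∀ v : Fin n → W,
      (∀ k ∈ s, π (v k) = 0) → (∀ k, k ∉ t → π (v k) = 0 ∨ ∃ l, v k = σ (e l)) →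
      η v = 0 := by
    intro t
    induction t using Finset.induction_on with
    | empty =>
      intro v h1 h2
      have h2' : ∀ k, ∃ l, π (v k) = 0 ∨ v k = σ (e l) := fun k => by
        rcases h2 k (by simp) with h | ⟨l, h⟩
        · exact ⟨k, Or.inl h⟩
        · exact ⟨l, Or.inr h⟩
      choose f hf using h2'
      by_cases hinj : Set.InjOn f (Finset.univ.filter (fun k => π (v k) ≠ 0) : Finset (Fin n))
      · obtain ⟨g, hg⟩ := Finset.exists_equiv_extend_of_card_eq (α := Fin n)
          (t := (Finset.univ : Finset (Fin n))) (by simp) (Finset.subset_univ _) hinj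
        let ρ : Fin n ≃ Fin n := g.trans (Equiv.subtypeUnivEquiv (by simp))
        have hρ : ∀ k, π (v k) ≠ 0 → ρ k = f k := fun k hk => hg k (by simpa using hk)
        refine S1 (e.reindex ρ.symm) Finset.univ v h1 (fun k _ => ?_)
        by_cases hk : π (v k) = 0
        · right; simpa using hk
        · left
          rcases hf k with h | h
          · exact absurd h hk
          · rw [h, hσ', Module.Basis.reindex_apply, Equiv.symm_symm, hρ k hk]
      · simp only [Set.InjOn, not_forall] at hinj
        obtain ⟨a, ha, b, hb, hab, hne⟩ := hinj
        have ha' : π (v a) ≠ 0 := by simpa using ha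
        have hb' : π (v b) ≠ 0 := by simpa using hb
        refine η.map_eq_zero_of_eq v ?_ hne
        rw [(hf a).resolve_left ha', (hf b).resolve_left hb', hab]
    | insert a t ha ih =>
      intro v h1 h2
      by_cases has : a ∈ s
      · refine ih v h1 (fun k hk => ?_)
        by_cases hka : k = a
        · subst hka; exact Or.inl (h1 _ has)
        · exact h2 k (by simp [hka, hk])
      have key : ∀ w : W, (π w = 0 ∨ ∃ l, w = σ (e l)) → η (Function.update v a w) = 0 := by
        intro w hw
        refine ih _ (fun k hk => ?_) (fun k hk => ?_)
        · have hka : k ≠ a := fun h => has (h ▸ hk)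
          simpa [hka] using h1 k hk
        · by_cases hka : k = a
          · subst hka; simpa using hw
          · simpa [hka] using h2 k (by simp [hka, hk])
      have dec : v a = (v a - σ (π (v a))) + ∑ l, e.repr (π (v a)) l • σ (e l) := by
        have : ∑ l, e.repr (π (v a)) l • σ (e l) = σ (π (v a)) := by
          conv_rhs => rw [← e.sum_repr (π (v a))]
          rw [map_sum]
          exact Finset.sum_congr rfl fun l _ => (map_smul _ _ _).symm
        rw [this]; abel
      rw [← Function.update_eq_self a v, dec, AlternatingMap.map_update_add,
        key _ (Or.inl (by rw [map_sub, hσ', sub_self])), zero_add,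
        AlternatingMap.map_update_sum]
      refine Finset.sum_eq_zero (fun l _ => ?_)
      rw [AlternatingMap.map_update_smul, key _ (Or.inr ⟨l, rfl⟩), smul_zero]
  exact S2 Finset.univ v hv (fun k hk => absurd (Finset.mem_univ k) hk)

lemma affine_of_inLambdaOne {n : ℕ} (π : W →ₗ[K] U) (η : W [⋀^Fin n]→ₗ[K] K)
    (h : InLambdaOne π η) : IsAffineOnSections π (fun σ => η.compLinearMap σ) := by
  intro σ τ hσ hτ
  have hd : ∀ u, π (τ u - σ u) = 0 := fun u => by
    have h1 := LinearMap.congr_fun hσ u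
    have h2 := LinearMap.congr_fun hτ u
    simp only [LinearMap.comp_apply, LinearMap.id_apply] at h1 h2
    rw [map_sub, h1, h2, sub_self]
  have key : ∀ (t : K) (u : Fin n → U), η (fun k => σ (u k) + t • (τ (u k) - σ (u k))) =
      η (fun k => σ (u k)) +
        t • η.toMultilinearMap.linearDeriv (fun k => σ (u k)) (fun k => τ (u k) - σ (u k)) := by
    intro t u
    have h1 := η.toMultilinearMap.map_add_eq_map_add_linearDeriv_add (fun k => σ (u k))
      (t • fun k => τ (u k) - σ (u k))
    rw [Finset.sum_eq_zero, add_zero, map_smul] at h1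
    · exact h1
    · intro s hs
      have hs' : 1 < s.card := (Finset.mem_filter.1 hs).2
      obtain ⟨i, hi, j, hj, hij⟩ := Finset.one_lt_card.1 hs'
      refine h _ ⟨i, j, hij, ?_, ?_⟩
      · simp only [Finset.piecewise_eq_of_mem _ _ _ hi, LinearMap.mem_ker, Pi.smul_apply,
          map_smul, hd, smul_zero]
      · simp only [Finset.piecewise_eq_of_mem _ _ _ hj, LinearMap.mem_ker, Pi.smul_apply,
          map_smul, hd, smul_zero]
  intro t
  ext u
  have h1 := key t u
  have h2 := key 1 u
  simp only [one_smul, add_sub_cancel] at h2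
  simp only [AlternatingMap.compLinearMap_apply, AlternatingMap.add_apply,
    AlternatingMap.smul_apply, AlternatingMap.sub_apply, LinearMap.add_apply,
    LinearMap.smul_apply, LinearMap.sub_apply]
  rw [h1, h2, add_sub_cancel_left]

lemma inLambdaOne_of_affine [CharZero K] {n : ℕ} (π : W →ₗ[K] U)
    (σ : U →ₗ[K] W) (hσ : π.comp σ = LinearMap.id)
    (e : Module.Basis (Fin n) K U) (η : W [⋀^Fin n]→ₗ[K] K)
    (h : IsAffineOnSections π (fun σ => η.compLinearMap σ)) : InLambdaOne π η := by
  classical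
  have hσ' : ∀ u, π (σ u) = u := fun u => by
    simpa using LinearMap.congr_fun hσ u
  rintro v ⟨i, j, hij, hi, hj⟩
  rw [LinearMap.mem_ker] at hi hj
  refine vanish_of_basis π σ hσ e η {i, j} ?_ v (by simp [hi, hj])
  clear hi hj v
  intro e' v hv1 hv2
  have hi : π (v i) = 0 := hv1 i (by simp)
  have hj : π (v j) = 0 := hv1 j (by simp)
  -- tuple form of additivity
  have tup : ∀ w x y : Fin n → W, (∀ k, π (w k) = e' k) → (∀ k, π (x k) = 0) →
      (∀ k, π (y k) = 0) → η (w + x + y) + η w = η (w + x) + η (w + y) := by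
    intro w x y hw hx hy
    have := affine_add h (σ := e'.constr K w) (δ := e'.constr K x) (ε := e'.constr K y)
      (e'.ext fun k => by simp [hw]) (e'.ext fun k => by simp [hx]) (e'.ext fun k => by simp [hy])
    have := congrArg (fun f => f e') this
    simp only [AlternatingMap.compLinearMap_apply, AlternatingMap.add_apply,
      LinearMap.add_apply, Module.Basis.constr_basis] at this
    exact this
  set w : Fin n → W := Function.update (Function.update v i (σ (e' i))) j (σ (e' j)) with hw
  have h1 := tup w (Pi.single i (v i)) (Pi.single j (v j)) (fun k => by
      by_cases hkj : k = j
      · subst hkj; simp [hw, hσ']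
      by_cases hki : k = i
      · subst hki; simp [hw, hkj, hσ']
      simpa [hw, hkj, hki] using hv2 k (by simp [hkj, hki]))
    (fun k => by
      by_cases hki : k = i
      · subst hki; simp [hi]
      · simp [hki])
    (fun k => by
      by_cases hki : k = j
      · subst hki; simp [hj]
      · simp [hki])
  let T : W → W → (Fin n → W) := fun a b => Function.update (Function.update v i a) j b
  have T1 : ∀ a a' b, η (T (a + a') b) = η (T a b) + η (T a' b) := by
    intro a a' b
    simp only [T, Function.update_comm hij]
    exact AlternatingMap.map_update_add _ _ _ _ _
  have T2 : ∀ a b b', η (T a (b + b')) = η (T a b) + η (T a b') := fun a b b' =>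
    AlternatingMap.map_update_add _ _ _ _ _
  have E0 : w = T (σ (e' i)) (σ (e' j)) := rfl
  have E1 : w + Pi.single i (v i) = T (σ (e' i) + v i) (σ (e' j)) := by
    funext k
    by_cases hkj : k = j
    · subst hkj; simp [T, w, Ne.symm hij]
    by_cases hki : k = i
    · subst hki; simp [T, w, hkj]
    simp [T, w, hkj, hki]
  have E2 : w + Pi.single j (v j) = T (σ (e' i)) (σ (e' j) + v j) := by
    funext k
    by_cases hkj : k = j
    · subst hkj; simp [T, w]
    by_cases hki : k = i
    · subst hki; simp [T, w, hkj]
    simp [T, w, hkj, hki]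
  have E3 : w + Pi.single i (v i) + Pi.single j (v j)
      = T (σ (e' i) + v i) (σ (e' j) + v j) := by
    rw [E1]
    funext k
    by_cases hkj : k = j
    · subst hkj; simp [T]
    by_cases hki : k = i
    · subst hki; simp [T, hkj]
    simp [T, hkj, hki]
  have E4 : T (v i) (v j) = v := by simp [T]
  rw [E3, E1, E2, E0] at h1
  simp only [T1, T2, E4] at h1
  linear_combination h1

lemma exists_form [CharZero K] {n : ℕ} (π : W →ₗ[K] U)
    (σ : U →ₗ[K] W) (hσ : π.comp σ = LinearMap.id)
    (e : Module.Basis (Fin n) K U) (F : (U →ₗ[K] W) → (U [⋀^Fin n]→ₗ[K] K))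
    (hF : IsAffineOnSections π F) :
    ∃ η : W [⋀^Fin n]→ₗ[K] K, InLambdaOne π η ∧
        ∀ τ : U →ₗ[K] W, π.comp τ = LinearMap.id → η.compLinearMap τ = F τ := by
  classical
  have hσ' : ∀ u, π (σ u) = u := fun u => by
    simpa using LinearMap.congr_fun hσ u
  let p : W →ₗ[K] W := LinearMap.id - σ.comp π
  have hp : π.comp p = 0 := by
    ext w; simp [p, hσ']
  have hpd : ∀ δ : U →ₗ[K] W, π.comp (p.comp δ) = 0 := fun δ => by
    rw [← LinearMap.comp_assoc, hp, LinearMap.zero_comp]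
  let L : (U →ₗ[K] W) →ₗ[K] K :=
    { toFun := fun δ => (F (σ + p.comp δ) - F σ) e
      map_add' := fun δ ε => by
        have h1 := affine_add hF hσ (hpd δ) (hpd ε)
        rw [LinearMap.comp_add, ← add_assoc, ← AlternatingMap.add_apply]
        congr 1
        rw [eq_sub_of_add_eq h1]; abel
      map_smul' := fun t δ => by
        have h1 := affine_smul hF hσ (hpd δ) t
        rw [LinearMap.comp_smul, h1]; rfl }
  let lam : Fin n → W →ₗ[K] K := fun l => L.comp (LinearMap.smulRightₗ (e.coord l))
  have hL : ∀ δ, L δ = ∑ l, lam l (δ (e l)) := by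
    intro δ
    have : δ = ∑ l, (e.coord l).smulRight (δ (e l)) := by
      refine e.ext fun k => ?_
      simp [Finsupp.single_apply]
    conv_lhs => rw [this]
    rw [map_sum]
    rfl
  let φ : Fin n → W →ₗ[K] U := fun l =>
    π - ((e.coord l).comp π).smulRight (e l) + ((lam l).comp p).smulRight (e l)
  let η : W [⋀^Fin n]→ₗ[K] K :=
    (F σ e) • e.det.compLinearMap π + ∑ l, e.det.compLinearMap (φ l)
  have hη : ∀ v, η v = F σ e * e.det (fun k => π (v k)) + ∑ l, e.det (fun k => φ l (v k)) := by
    intro v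
    have hsum : ∀ s : Finset (Fin n), (∑ l ∈ s, e.det.compLinearMap (φ l)) v
        = ∑ l ∈ s, e.det (fun k => φ l (v k)) := by
      intro s
      induction s using Finset.induction_on with
      | empty => simp
      | insert a s ha ih =>
        rw [Finset.sum_insert ha, Finset.sum_insert ha, AlternatingMap.add_apply, ih]
        rfl
    simp only [η, AlternatingMap.add_apply, hsum]
    rfl
  refine ⟨η, ?_, ?_⟩
  · rintro v ⟨i, j, hij, hi, hj⟩
    rw [LinearMap.mem_ker] at hi hj
    rw [hη, AlternatingMap.map_coord_zero e.det i hi, mul_zero, zero_add]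
    refine Finset.sum_eq_zero fun l _ => ?_
    have hφ : ∀ k, π (v k) = 0 → φ l (v k) = lam l (p (v k)) • e l := fun k hk => by
      simp [φ, hk]
    have e1 : (fun k => φ l (v k)) = Function.update (Function.update (fun k => φ l (v k))
        i (lam l (p (v i)) • e l)) j (lam l (p (v j)) • e l) := by
      rw [← hφ i hi, ← hφ j hj]; simp
    rw [e1, AlternatingMap.map_update_smul, Function.update_comm hij,
      AlternatingMap.map_update_smul]
    rw [AlternatingMap.map_eq_zero_of_eq _ _ _ hij, smul_zero, smul_zero]
    simp [Ne.symm hij]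
  · intro τ hτ
    have hτ' : ∀ u, π (τ u) = u := fun u => by
      simpa using LinearMap.congr_fun hτ u
    have hpp : p.comp p = p := by
      ext w; simp [p, hσ']
    have hlam : ∀ l w, lam l (p w) = lam l w := by
      intro l w
      have h0 : ∀ x, p.comp ((e.coord l).smulRight x) = (e.coord l).smulRight (p x) := by
        intro x; ext u; simp
      have h1 : p (p w) = p w := LinearMap.congr_fun hpp w
      change (F (σ + p.comp ((e.coord l).smulRight (p w))) - F σ) e
        = (F (σ + p.comp ((e.coord l).smulRight w)) - F σ) e
      rw [h0, h0, h1]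
    have hφ : ∀ l, e.det (fun k => φ l (τ (e k))) = lam l (τ (e l)) := by
      intro l
      have hm : e.toMatrix (fun k => φ l (τ (e k))) = (1 : Matrix (Fin n) (Fin n) K).updateRow l
          (∑ k, lam l (τ (e k)) • (1 : Matrix (Fin n) (Fin n) K) k) := by
        ext a b
        by_cases ha : a = l
        · subst ha
          simp [Module.Basis.toMatrix_apply, φ, hτ', hlam, Finset.sum_apply, Matrix.one_apply]
        · simp [Module.Basis.toMatrix_apply, φ, hτ', ha, Matrix.one_apply,
            Finsupp.single_apply, eq_comm]
          split_ifs <;> simp [Ne.symm ha]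
      rw [Module.Basis.det_apply, hm, Matrix.det_updateRow_sum, Matrix.det_one, smul_eq_mul,
        mul_one]
    have hval : η (fun k => τ (e k)) = F τ e := by
      rw [hη]
      simp only [hφ, hτ', Module.Basis.det_self, mul_one]
      rw [← hL]
      have h1 : σ + p.comp τ = τ := by
        ext u; simp [p, hτ']
      change F σ e + (F (σ + p.comp τ) - F σ) e = F τ e
      rw [h1, AlternatingMap.sub_apply, add_sub_cancel]
    rw [(η.compLinearMap τ).eq_smul_basis_det e, (F τ).eq_smul_basis_det e, ← hval]
    rfl

end Helpers

/-- for a surjective linear map `π : W → U` with kernel `V` over a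
field of characteristic zero, and `n = dim U`, the map `η ↦ η̂`,
`η̂(σ) = σ*η`, identifies `Λⁿ₁W* = {η : ι_{v₂}ι_{v₁}η = 0 ∀ v₁,v₂ ∈ V}`
with the space of affine maps `S → ΛⁿU*` on the space `S` of linear sections
of `π`: (a) `η̂` is affine iff `η ∈ Λⁿ₁W*`; (b) every affine map `F : S → ΛⁿU*`
comes from a unique `η ∈ Λⁿ₁W*` (so `η ↦ η̂` is a linear isomorphism onto
`Aff(S, ΛⁿU*)`). -/
theorem stmt1 {K W U : Type*} [Field K] [CharZero K]
    [AddCommGroup W] [Module K W] [FiniteDimensional K W]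
    [AddCommGroup U] [Module K U] [FiniteDimensional K U]
    (π : W →ₗ[K] U) (hπ : Function.Surjective π)
    {n : ℕ} (hn : n = Module.finrank K U) :
    (∀ η : W [⋀^Fin n]→ₗ[K] K,
      IsAffineOnSections π (fun σ => η.compLinearMap σ) ↔ InLambdaOne π η)
    ∧
    (∀ F : (U →ₗ[K] W) → (U [⋀^Fin n]→ₗ[K] K), IsAffineOnSections π F →
      ∃! η : W [⋀^Fin n]→ₗ[K] K, InLambdaOne π η ∧
        ∀ σ : U →ₗ[K] W, π.comp σ = LinearMap.id → η.compLinearMap σ = F σ) := by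
  obtain ⟨σ, hσ⟩ := π.exists_rightInverse_of_surjective (LinearMap.range_eq_top.2 hπ)
  let e : Module.Basis (Fin n) K U := Module.finBasisOfFinrankEq K U hn.symm
  refine ⟨fun η => ⟨inLambdaOne_of_affine π σ hσ e η, affine_of_inLambdaOne π η⟩,
    fun F hF => ?_⟩
  obtain ⟨η, h1, h2⟩ := exists_form π σ hσ e F hF
  refine ⟨η, ⟨h1, h2⟩, ?_⟩
  rintro η' ⟨-, h3⟩
  rw [← sub_eq_zero]
  ext v
  refine vanish_of_basis π σ hσ e (η' - η) ∅ ?_ v (by simp)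
  intro e' w _ hw
  have hs : π.comp (e'.constr K w) = LinearMap.id :=
    e'.ext fun k => by simpa using hw k (by simp)
  have h4 := congrArg (fun f => f e') ((h3 _ hs).trans (h2 _ hs).symm)
  have h5 : η' w = η w := by
    simpa [Function.comp_def, Module.Basis.constr_basis] using h4
  rw [AlternatingMap.sub_apply, h5, sub_self]
end

section
/- Let Ω ∈ Λ²(ℝ^{2n})* be a non-degenerate alternating 2-form and 0 ≤ p < n. Then the map Λ^p(ℝ^{2n})* → Λ^{2n-p}(ℝ^{2n})*, η ↦ η ∧ Ω^{n-p}, is a linear bijection (Lepage's divisibility theorem). -/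
namespace Stmt7

variable {V : Type*} [AddCommGroup V] [Module ℝ V]

/-- Wedge product of alternating forms (via `domCoprod`, the sum over
shuffles). -/
noncomputable def wedge {p q : ℕ} (α : V [⋀^Fin p]→ₗ[ℝ] ℝ)
    (β : V [⋀^Fin q]→ₗ[ℝ] ℝ) : V [⋀^Fin (p + q)]→ₗ[ℝ] ℝ :=
  ((TensorProduct.lid ℝ ℝ).toLinearMap.compAlternatingMap
    (α.domCoprod β)).domDomCongr finSumFinEquiv

/-- The `j`-fold wedge power of a 2-form. -/
noncomputable def wpowA (Ω : V [⋀^Fin 2]→ₗ[ℝ] ℝ) :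
    (j : ℕ) → V [⋀^Fin (2 * j)]→ₗ[ℝ] ℝ
  | 0 => (AlternatingMap.constOfIsEmpty ℝ V (Fin 0) 1).domDomCongr
      (finCongr (by omega))
  | j + 1 => (wedge Ω (wpowA Ω j)).domDomCongr (finCongr (by omega))

/-- One summand in the full-permutation expression of the wedge product. -/
noncomputable def G {p q N : ℕ} (h : p + q = N) (α : V [⋀^Fin p]→ₗ[ℝ] ℝ)
    (β : V [⋀^Fin q]→ₗ[ℝ] ℝ) (w : Fin N → V) : ℝ :=
  α (fun i => w ⟨i, by omega⟩) * β (fun j => w ⟨p + j, by omega⟩)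

/-- The full-permutation sum. -/
noncomputable def T {p q N : ℕ} (h : p + q = N) (α : V [⋀^Fin p]→ₗ[ℝ] ℝ)
    (β : V [⋀^Fin q]→ₗ[ℝ] ℝ) (v : Fin N → V) : ℝ :=
  ∑ σ : Equiv.Perm (Fin N), ((Equiv.Perm.sign σ : ℤ) : ℝ) * G h α β (v ∘ σ)

theorem perm_bij (M : ℕ) : Function.Bijective
    (fun x : Fin (M + 1) × Equiv.Perm (Fin M) =>
      Equiv.Perm.decomposeFin.symm (0, x.2) * Fin.cycleRange x.1) := by
  rw [Fintype.bijective_iff_injective_and_card]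
  constructor
  · rintro ⟨i, e⟩ ⟨i', e'⟩ h
    simp only at h
    have key : ∀ (i : Fin (M + 1)) (e : Equiv.Perm (Fin M)),
        (Equiv.Perm.decomposeFin.symm (0, e) * Fin.cycleRange i) i = 0 := by
      intro i e
      rw [Equiv.Perm.mul_apply, Fin.cycleRange_self, Equiv.Perm.decomposeFin_symm_apply_zero]
    have hi : i = i' := by
      have h1 := key i e
      rw [h] at h1
      exact Equiv.injective _ (h1.trans (key i' e').symm)
    subst hi
    have h1 := mul_right_cancel h
    have h2 := Equiv.Perm.decomposeFin.symm.injective h1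
    rw [Prod.mk.injEq] at h2
    rw [h2.2]
  · simp [Fintype.card_perm, Nat.factorial_succ]

theorem T_succ {p q M : ℕ} (h : p + q = M + 1) (α : V [⋀^Fin p]→ₗ[ℝ] ℝ)
    (β : V [⋀^Fin q]→ₗ[ℝ] ℝ) (a : V) (u : Fin M → V) :
    T h α β (Fin.cons a u : Fin (M + 1) → V) =
      ∑ i : Fin (M + 1), (-1 : ℝ) ^ (i : ℕ) * ∑ e : Equiv.Perm (Fin M),
        ((Equiv.Perm.sign e : ℤ) : ℝ) *
          G h α β (Fin.insertNth (α := fun _ => V) i a (u ∘ e)) := by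
  unfold T
  rw [← (perm_bij M).sum_comp, Fintype.sum_prod_type]
  refine Finset.sum_congr rfl fun i _ => ?_
  rw [Finset.mul_sum]
  refine Finset.sum_congr rfl fun e _ => ?_
  have h1 : (Fin.cons a u : Fin (M + 1) → V) ∘
      (Equiv.Perm.decomposeFin.symm (0, e) * Fin.cycleRange i : Equiv.Perm (Fin (M + 1)))
      = Fin.insertNth (α := fun _ => V) i a (u ∘ e) := by
    have h2 := Fin.cons_comp_cycleRange a (u ∘ e) i
    rw [← h2, Equiv.Perm.coe_mul, ← Function.comp_assoc]
    congr 1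
    funext j
    refine Fin.cases ?_ (fun j => ?_) j
    · simp
    · simp
  rw [h1, Equiv.Perm.sign_mul, Fin.sign_cycleRange, Equiv.Perm.decomposeFin.symm_sign]
  push_cast
  simp
  ring

theorem G_left {p q M : ℕ} (h : p + 1 + q = M + 1) (α : V [⋀^Fin (p + 1)]→ₗ[ℝ] ℝ)
    (β : V [⋀^Fin q]→ₗ[ℝ] ℝ) (a : V) (w : Fin M → V) (i : Fin (p + 1)) :
    G h α β (Fin.insertNth (α := fun _ => V) (⟨i, by omega⟩ : Fin (M + 1)) a w) =
      (-1 : ℝ) ^ (i : ℕ) * G (show p + q = M by omega) (α.curryLeft a) β w := by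
  unfold G
  have h1 : (fun k : Fin (p + 1) => (Fin.insertNth (α := fun _ => V)
      (⟨i, by omega⟩ : Fin (M + 1)) a w : Fin (M + 1) → V) ⟨k, by omega⟩) =
      Fin.insertNth (α := fun _ => V) i a (fun k : Fin p => w ⟨k, by omega⟩) := by
    rw [Fin.eq_insertNth_iff]
    constructor
    · exact Fin.insertNth_apply_same (α := fun _ => V) (⟨i, by omega⟩ : Fin (M + 1)) a w
    · funext k
      rw [← Fin.insertNth_apply_succAbove (α := fun _ => V)
        (⟨i, by omega⟩ : Fin (M + 1)) a w ⟨k, by omega⟩]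
      unfold Fin.removeNth
      beta_reduce
      refine congrArg _ (Fin.ext ?_)
      simp only [Fin.succAbove, Fin.lt_def]
      split_ifs <;> simp_all <;> omega
  have h2 : (fun j : Fin q => (Fin.insertNth (α := fun _ => V)
      (⟨i, by omega⟩ : Fin (M + 1)) a w : Fin (M + 1) → V) ⟨p + 1 + j, by omega⟩) =
      fun j : Fin q => w ⟨p + j, by omega⟩ := by
    funext j
    rw [← Fin.insertNth_apply_succAbove (α := fun _ => V)
        (⟨i, by omega⟩ : Fin (M + 1)) a w ⟨p + j, by omega⟩]
    refine congrArg _ (Fin.ext ?_)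
    simp only [Fin.succAbove, Fin.lt_def]
    split_ifs <;> simp_all <;> omega
  rw [h1, h2, AlternatingMap.map_insertNth, AlternatingMap.curryLeft_apply_apply,
    zsmul_eq_mul]
  push_cast
  ring

theorem G_right {p q M : ℕ} (h : p + (q + 1) = M + 1) (α : V [⋀^Fin p]→ₗ[ℝ] ℝ)
    (β : V [⋀^Fin (q + 1)]→ₗ[ℝ] ℝ) (a : V) (w : Fin M → V) (i : Fin (q + 1)) :
    G h α β (Fin.insertNth (α := fun _ => V) (⟨p + i, by omega⟩ : Fin (M + 1)) a w) =
      (-1 : ℝ) ^ (i : ℕ) * G (show p + q = M by omega) α (β.curryLeft a) w := by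
  unfold G
  have h1 : (fun k : Fin (q + 1) => (Fin.insertNth (α := fun _ => V)
      (⟨p + i, by omega⟩ : Fin (M + 1)) a w : Fin (M + 1) → V) ⟨p + k, by omega⟩) =
      Fin.insertNth (α := fun _ => V) i a (fun k : Fin q => w ⟨p + k, by omega⟩) := by
    rw [Fin.eq_insertNth_iff]
    constructor
    · exact Fin.insertNth_apply_same (α := fun _ => V) (⟨p + i, by omega⟩ : Fin (M + 1)) a w
    · funext k
      rw [← Fin.insertNth_apply_succAbove (α := fun _ => V)
        (⟨p + i, by omega⟩ : Fin (M + 1)) a w ⟨p + k, by omega⟩]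
      unfold Fin.removeNth
      beta_reduce
      refine congrArg _ (Fin.ext ?_)
      simp only [Fin.succAbove, Fin.lt_def]
      split_ifs <;> simp_all <;> omega
  have h2 : (fun j : Fin p => (Fin.insertNth (α := fun _ => V)
      (⟨p + i, by omega⟩ : Fin (M + 1)) a w : Fin (M + 1) → V) ⟨j, by omega⟩) =
      fun j : Fin p => w ⟨j, by omega⟩ := by
    funext j
    rw [← Fin.insertNth_apply_succAbove (α := fun _ => V)
        (⟨p + i, by omega⟩ : Fin (M + 1)) a w ⟨j, by omega⟩]
    refine congrArg _ (Fin.ext ?_)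
    simp only [Fin.succAbove, Fin.lt_def]
    split_ifs <;> simp_all <;> omega
  rw [h1, h2, AlternatingMap.map_insertNth, AlternatingMap.curryLeft_apply_apply,
    zsmul_eq_mul]
  push_cast
  ring

theorem sum_split {p q M : ℕ} (h : p + q = M) (f : Fin M → ℝ) :
    ∑ i, f i = ∑ i : Fin p, f ⟨i, by omega⟩ + ∑ j : Fin q, f ⟨p + j, by omega⟩ := by
  subst h
  rw [Fin.sum_univ_add]
  rfl

theorem neg_one_sq_pow (k : ℕ) : (-1 : ℝ) ^ k * (-1) ^ k = 1 := by
  rw [← mul_pow]; simp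

theorem left_part {p q M : ℕ} (h : p + 1 + q = M + 1) (α : V [⋀^Fin (p + 1)]→ₗ[ℝ] ℝ)
    (β : V [⋀^Fin q]→ₗ[ℝ] ℝ) (a : V) (u : Fin M → V) :
    ∑ i : Fin (p + 1), (-1 : ℝ) ^ (i : ℕ) * ∑ e : Equiv.Perm (Fin M),
        ((Equiv.Perm.sign e : ℤ) : ℝ) *
          G h α β (Fin.insertNth (α := fun _ => V) (⟨i, by omega⟩ : Fin (M + 1)) a (u ∘ e))
      = (p + 1) * T (show p + q = M by omega) (α.curryLeft a) β u := by
  have : ∀ i : Fin (p + 1), (-1 : ℝ) ^ (i : ℕ) * ∑ e : Equiv.Perm (Fin M),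
        ((Equiv.Perm.sign e : ℤ) : ℝ) *
          G h α β (Fin.insertNth (α := fun _ => V) (⟨i, by omega⟩ : Fin (M + 1)) a (u ∘ e))
      = T (show p + q = M by omega) (α.curryLeft a) β u := by
    intro i
    unfold T
    rw [Finset.mul_sum]
    refine Finset.sum_congr rfl fun e _ => ?_
    rw [G_left]
    linear_combination ((Equiv.Perm.sign e : ℤ) : ℝ) *
      G (show p + q = M by omega) (α.curryLeft a) β (u ∘ e) * neg_one_sq_pow i
  simp only [this]
  simp

theorem right_part {p q M : ℕ} (h : p + (q + 1) = M + 1) (α : V [⋀^Fin p]→ₗ[ℝ] ℝ)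
    (β : V [⋀^Fin (q + 1)]→ₗ[ℝ] ℝ) (a : V) (u : Fin M → V) :
    ∑ i : Fin (q + 1), (-1 : ℝ) ^ (p + i : ℕ) * ∑ e : Equiv.Perm (Fin M),
        ((Equiv.Perm.sign e : ℤ) : ℝ) *
          G h α β (Fin.insertNth (α := fun _ => V) (⟨p + i, by omega⟩ : Fin (M + 1)) a (u ∘ e))
      = (q + 1) * ((-1) ^ p * T (show p + q = M by omega) α (β.curryLeft a) u) := by
  have : ∀ i : Fin (q + 1), (-1 : ℝ) ^ (p + i : ℕ) * ∑ e : Equiv.Perm (Fin M),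
        ((Equiv.Perm.sign e : ℤ) : ℝ) *
          G h α β (Fin.insertNth (α := fun _ => V) (⟨p + i, by omega⟩ : Fin (M + 1)) a (u ∘ e))
      = (-1) ^ p * T (show p + q = M by omega) α (β.curryLeft a) u := by
    intro i
    unfold T
    rw [Finset.mul_sum, Finset.mul_sum]
    refine Finset.sum_congr rfl fun e _ => ?_
    rw [G_right, pow_add]
    linear_combination (-1) ^ p * ((Equiv.Perm.sign e : ℤ) : ℝ) *
      G (show p + q = M by omega) α (β.curryLeft a) (u ∘ e) * neg_one_sq_pow i
  simp only [this]
  simp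

theorem wedge_T {p q : ℕ} (α : V [⋀^Fin p]→ₗ[ℝ] ℝ)
    (β : V [⋀^Fin q]→ₗ[ℝ] ℝ) (v : Fin (p + q) → V) :
    (p.factorial * q.factorial : ℝ) * wedge α β v = T rfl α β v := by
  have h := congrArg (fun f => TensorProduct.lid ℝ ℝ (f (v ∘ finSumFinEquiv)))
    (MultilinearMap.domCoprod_alternization_eq α β)
  simp only [Fintype.card_fin, AlternatingMap.smul_apply] at h
  rw [map_nsmul, nsmul_eq_mul, Nat.cast_mul] at h
  have h0 : wedge α β v = TensorProduct.lid ℝ ℝ (α.domCoprod β (v ∘ finSumFinEquiv)) := rfl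
  rw [h0, ← h, MultilinearMap.alternatization_apply, map_sum]
  unfold T
  rw [← (finSumFinEquiv.permCongr).sum_comp]
  refine Finset.sum_congr rfl fun σ _ => ?_
  rw [Equiv.Perm.sign_permCongr]
  have hL : ∀ i : Fin p, finSumFinEquiv.symm (⟨i, by omega⟩ : Fin (p + q)) = Sum.inl i :=
    fun i => finSumFinEquiv_symm_apply_castAdd i
  have hR : ∀ i : Fin q, finSumFinEquiv.symm (⟨p + i, by omega⟩ : Fin (p + q)) = Sum.inr i :=
    fun i => finSumFinEquiv_symm_apply_natAdd i
  simp only [smul_apply, Units.smul_def]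
  rw [map_zsmul, zsmul_eq_mul]
  simp [G, MultilinearMap.domDomCongr_apply, MultilinearMap.domCoprod_apply, hL, hR]

/-- Contraction on functions of lists. -/
def io {W : Type*} (v : W) (f : List W → ℝ) : List W → ℝ := fun l => f (v :: l)

/-- Parity twist. -/
def tw {W : Type*} (f : List W → ℝ) : List W → ℝ := fun l => (-1) ^ l.length * f l

/-- Signed shuffle product, evaluated at a list. -/
def wl {W : Type*} : List W → (List W → ℝ) → (List W → ℝ) → ℝ
  | [], f, g => f [] * g []
  | v :: l, f, g => wl l (io v f) g + wl l (tw f) (io v g)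

/-- Signed shuffle product. -/
def mu {W : Type*} (f g : List W → ℝ) : List W → ℝ := fun l => wl l f g

section ListAlg

variable {W : Type*}

theorem mu_nil (f g : List W → ℝ) : mu f g [] = f [] * g [] := rfl

theorem mu_cons (f g : List W → ℝ) (v : W) (l : List W) :
    mu f g (v :: l) = mu (io v f) g l + mu (tw f) (io v g) l := rfl

theorem io_mu (f g : List W → ℝ) (v : W) :
    io v (mu f g) = mu (io v f) g + mu (tw f) (io v g) := rfl

theorem io_add (f g : List W → ℝ) (v : W) : io v (f + g) = io v f + io v g := rfl
theorem io_smul (c : ℝ) (f : List W → ℝ) (v : W) : io v (c • f) = c • io v f := rfl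
theorem io_zero (v : W) : io v (0 : List W → ℝ) = 0 := rfl

theorem tw_add (f g : List W → ℝ) : tw (f + g) = tw f + tw g := by
  funext l; simp [tw, mul_add]
theorem tw_smul (c : ℝ) (f : List W → ℝ) : tw (c • f) = c • tw f := by
  funext l; simp [tw]; ring
theorem tw_tw (f : List W → ℝ) : tw (tw f) = f := by
  funext l; simp [tw, ← mul_assoc, ← mul_pow]
theorem io_tw (f : List W → ℝ) (v : W) : io v (tw f) = (-1 : ℝ) • tw (io v f) := by
  funext l; simp [tw, io, pow_succ]

theorem tw_zero : tw (0 : List W → ℝ) = 0 := by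
  funext l; simp [tw]

theorem mu_add_left (f f' g : List W → ℝ) : mu (f + f') g = mu f g + mu f' g := by
  funext l
  induction l generalizing f f' g with
  | nil => simp [mu_nil, add_mul]
  | cons v l ih =>
    simp only [mu_cons, Pi.add_apply, io_add, tw_add, ih]; ring

theorem mu_add_right (f g g' : List W → ℝ) : mu f (g + g') = mu f g + mu f g' := by
  funext l
  induction l generalizing f g g' with
  | nil => simp [mu_nil, mul_add]
  | cons v l ih =>
    simp only [mu_cons, Pi.add_apply, io_add, ih]; ring

theorem mu_smul_left (c : ℝ) (f g : List W → ℝ) : mu (c • f) g = c • mu f g := by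
  funext l
  induction l generalizing f g with
  | nil => simp [mu_nil, mul_assoc]
  | cons v l ih =>
    simp only [mu_cons, Pi.smul_apply, smul_eq_mul, io_smul, tw_smul, ih]; ring

theorem mu_smul_right (c : ℝ) (f g : List W → ℝ) : mu f (c • g) = c • mu f g := by
  funext l
  induction l generalizing f g with
  | nil => simp [mu_nil]; ring
  | cons v l ih =>
    simp only [mu_cons, Pi.smul_apply, smul_eq_mul, io_smul, ih]; ring

theorem mu_zero_left (g : List W → ℝ) : mu 0 g = 0 := by
  have := mu_smul_left 0 0 g
  simpa using this

theorem mu_zero_right (g : List W → ℝ) : mu g 0 = 0 := by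
  have := mu_smul_right 0 g 0
  simpa using this

theorem tw_mu (f g : List W → ℝ) : tw (mu f g) = mu (tw f) (tw g) := by
  funext l
  induction l generalizing f g with
  | nil => simp [mu_nil, tw]
  | cons v l ih =>
    have h1 := ih (io v f) g
    have h2 := ih (tw f) (io v g)
    simp only [mu_cons, io_tw, mu_smul_left, mu_smul_right, Pi.smul_apply, smul_eq_mul]
    rw [← h1, ← h2]
    simp only [tw, mu_cons, List.length_cons, pow_succ]
    ring

theorem mu_assoc (f g h : List W → ℝ) : mu (mu f g) h = mu f (mu g h) := by
  funext l
  induction l generalizing f g h with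
  | nil => simp [mu_nil, mul_assoc]
  | cons v l ih =>
    simp only [mu_cons, io_mu, tw_mu, mu_add_left, mu_add_right, Pi.add_apply, ih]
    ring

theorem io_even {g : List W → ℝ} (hg : tw g = g) (v : W) :
    tw (io v g) = (-1 : ℝ) • io v g := by
  have := io_tw g v
  rw [hg] at this
  have h2 := congrArg (fun f => (-1 : ℝ) • f) this
  simpa using h2.symm

theorem io_odd {g : List W → ℝ} (hg : tw g = (-1 : ℝ) • g) (v : W) :
    tw (io v g) = io v g := by
  have := io_tw g v
  rw [hg, io_smul] at this
  simpa using this.symm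

theorem mu_comm_aux (l : List W) : ∀ f g : List W → ℝ,
    (tw g = g → mu f g l = mu g f l) ∧
    (tw g = (-1 : ℝ) • g → mu f g l = mu g (tw f) l) := by
  induction l with
  | nil =>
    intro f g
    simp [mu_nil, tw, mul_comm]
  | cons v l ih =>
    intro f g
    constructor
    · intro hg
      rw [mu_cons, mu_cons, hg, (ih (io v f) g).1 hg, (ih (tw f) (io v g)).2 (io_even hg v),
        tw_tw, add_comm]
    · intro hg
      rw [mu_cons, mu_cons, hg, (ih (io v f) g).2 hg, (ih (tw f) (io v g)).1 (io_odd hg v),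
        io_tw, mu_smul_left, mu_smul_right]
      simp [add_comm]

theorem mu_comm_even (f : List W → ℝ) {g : List W → ℝ} (hg : tw g = g) : mu f g = mu g f :=
  funext fun l => (mu_comm_aux l f g).1 hg

/-- powers -/
def pw (Ω one : List W → ℝ) : ℕ → (List W → ℝ)
  | 0 => one
  | j + 1 => mu Ω (pw Ω one j)

/-- support in degree `p` -/
def Sup (p : ℕ) (f : List W → ℝ) : Prop := ∀ l, l.length ≠ p → f l = 0

theorem Sup.io {p : ℕ} {f : List W → ℝ} (h : Sup (p + 1) f) (v : W) : Sup p (io v f) :=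
  fun l hl => h _ (by simpa using hl)

theorem Sup.io_zero {f : List W → ℝ} (h : Sup 0 f) (v : W) : Stmt7.io v f = 0 :=
  funext fun _ => h _ (by simp)

theorem Sup.tw {p : ℕ} {f : List W → ℝ} (h : Sup p f) : Stmt7.tw f = (-1 : ℝ) ^ p • f := by
  funext l
  by_cases hl : l.length = p
  · simp [Stmt7.tw, hl]
  · simp [Stmt7.tw, h l hl]

theorem Sup.smul {p : ℕ} {f : List W → ℝ} (h : Sup p f) (c : ℝ) : Sup p (c • f) :=
  fun l hl => by simp [h l hl]

theorem Sup.mu {p q : ℕ} {f g : List W → ℝ} (hf : Sup p f) (hg : Sup q g) :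
    Sup (p + q) (mu f g) := by
  intro l
  induction l generalizing p q f g with
  | nil =>
    intro hl
    rw [mu_nil]
    by_cases hp : p = 0
    · rw [hg [] (by simp at hl ⊢; omega), mul_zero]
    · rw [hf [] (by simp; omega), zero_mul]
  | cons v l ih =>
    intro hl
    simp only [List.length_cons] at hl
    rw [mu_cons, hf.tw, mu_smul_left]
    have h1 : Stmt7.mu (Stmt7.io v f) g l = 0 := by
      cases p with
      | zero => rw [hf.io_zero, mu_zero_left]; rfl
      | succ p => exact ih (hf.io v) hg (by omega)
    have h2 : Stmt7.mu f (Stmt7.io v g) l = 0 := by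
      cases q with
      | zero => rw [hg.io_zero, mu_zero_right]; rfl
      | succ q => exact ih hf (hg.io v) (by omega)
    simp [h1, h2]

theorem mu_sup_zero {f : List W → ℝ} (hf : Sup 0 f) (g : List W → ℝ) :
    mu f g = f [] • g := by
  funext l
  induction l generalizing g with
  | nil => simp [mu_nil]
  | cons v l ih =>
    have h := hf.tw
    rw [mu_cons, h, hf.io_zero, mu_zero_left, pow_zero, one_smul, ih]
    simp [io]

theorem mu_vanish (l : List W) : ∀ f g : List W → ℝ,
    (∀ l', (∀ y ∈ l', y ∈ l) → f l' = 0) → mu f g l = 0 := by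
  induction l with
  | nil =>
    intro f g h
    rw [mu_nil, h [] (by simp), zero_mul]
  | cons v l ih =>
    intro f g h
    rw [mu_cons, ih, ih, add_zero]
    · intro l' hl'
      simp only [tw]
      rw [h l' (fun y hy => List.mem_cons_of_mem _ (hl' y hy)), mul_zero]
    · intro l' hl'
      refine h _ ?_
      intro y hy
      rcases List.mem_cons.1 hy with rfl | hy
      · simp
      · exact List.mem_cons_of_mem _ (hl' y hy)

section Om

variable {Ω one : List W → ℝ}

theorem pw_sup (hΩ : Sup 2 Ω) (h1 : Sup 0 one) (m : ℕ) : Sup (2 * m) (pw Ω one m) := by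
  induction m with
  | zero => exact h1
  | succ m ih =>
    have := hΩ.mu ih
    rwa [show 2 + 2 * m = 2 * (m + 1) by ring] at this

theorem io_pw (hΩ : Sup 2 Ω) (h1 : Sup 0 one) (v : W) (m : ℕ) :
    io v (pw Ω one (m + 1)) = ((m : ℝ) + 1) • mu (io v Ω) (pw Ω one m) := by
  have hΩe : tw Ω = Ω := by simpa using hΩ.tw
  induction m with
  | zero =>
    simp [pw, io_mu, h1.io_zero, mu_zero_right]
  | succ m ih =>
    have e : pw Ω one (m + 1 + 1) = mu Ω (pw Ω one (m + 1)) := rfl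
    have e' : pw Ω one (m + 1) = mu Ω (pw Ω one m) := rfl
    rw [e, io_mu, ih, hΩe, mu_smul_right, ← mu_assoc, ← mu_comm_even (io v Ω) hΩe, mu_assoc,
      ← e']
    push_cast
    module

theorem lepage_inj (hΩ : Sup 2 Ω) (h1 : Sup 0 one) (n : ℕ) (hn : pw Ω one n ≠ 0) (p m : ℕ)
    (hpm : p + m = n) (η : List W → ℝ) (hη : Sup p η) (h0 : mu η (pw Ω one m) = 0) :
    η = 0 := by
  have hΩe : tw Ω = Ω := by simpa using hΩ.tw
  induction p generalizing m η with
  | zero =>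
    have : m = n := by omega
    subst this
    rw [mu_sup_zero hη] at h0
    have h2 : η [] = 0 := by
      rcases smul_eq_zero.1 h0 with h | h
      · exact h
      · exact absurd h hn
    funext l
    cases l with
    | nil => exact h2
    | cons v l => exact hη _ (by simp)
  | succ p ih =>
    have key : ∀ v, io v η = 0 := by
      intro v
      refine ih (m + 1) (by omega) (io v η) (hη.io v) ?_
      have e1 : pw Ω one (m + 1) = mu (pw Ω one m) Ω := (mu_comm_even _ hΩe).symm
      have h2 : mu (io v η) (pw Ω one m) + mu (tw η) (io v (pw Ω one m)) = 0 := by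
        rw [← io_mu, h0, io_zero]
      have h3 : mu (tw η) (mu (io v (pw Ω one m)) Ω) = 0 := by
        cases m with
        | zero => rw [show pw Ω one 0 = one from rfl, h1.io_zero, mu_zero_left, mu_zero_right]
        | succ m =>
          rw [io_pw hΩ h1, mu_smul_left, mu_assoc, mu_comm_even (pw Ω one m) hΩe,
            show mu Ω (pw Ω one m) = pw Ω one (m + 1) from rfl, mu_smul_right]
          have e2 : tw (pw Ω one (m + 1)) = pw Ω one (m + 1) := by
            simpa using (pw_sup hΩ h1 (m + 1)).tw
          rw [mu_comm_even (io v Ω) e2, ← mu_assoc]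
          have h4 : mu (tw η) (pw Ω one (m + 1)) = 0 := by
            rw [hη.tw, mu_smul_left, h0, smul_zero]
          rw [h4, mu_zero_left, smul_zero]
      rw [e1, ← mu_assoc]
      have h5 := congrArg (fun f => mu f Ω) h2
      simp only [mu_add_left, mu_zero_left] at h5
      rw [mu_assoc (tw η), h3, add_zero] at h5
      exact h5
    funext l
    cases l with
    | nil => exact hη _ (by simp)
    | cons v l => exact congrFun (key v) l

theorem pw_step (hΩ : Sup 2 Ω) (h1 : Sup 0 one) (n : ℕ)
    (hnd : ∀ l : List W, l.length < 2 * n → ∃ v x, (∀ y ∈ l, Ω [v, y] = 0) ∧ Ω [v, x] ≠ 0)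
    (hone : one [] ≠ 0) (k : ℕ) (hk : k ≤ n) : pw Ω one k ≠ 0 := by
  induction k with
  | zero => exact fun h => hone (congrFun h [])
  | succ k ih =>
    intro h0
    refine ih (by omega) ?_
    funext l
    by_cases hl : l.length = 2 * k
    · obtain ⟨v, x, hv, hx⟩ := hnd l (by omega)
      have h2 := congrFun (io_pw hΩ h1 v k) (x :: l)
      rw [h0, io_zero] at h2
      have h3 : (0 : ℝ) = (k + 1) * mu (io v Ω) (pw Ω one k) (x :: l) := h2
      have h4 : mu (io v Ω) (pw Ω one k) (x :: l) = 0 := by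
        rcases mul_eq_zero.1 h3.symm with h | h
        · exact absurd h (by positivity)
        · exact h
      have hs := hΩ.io v
      rw [mu_cons, hs.tw, mu_smul_left, mu_sup_zero (hs.io x)] at h4
      have h5 : mu (io v Ω) (io x (pw Ω one k)) l = 0 := by
        refine mu_vanish l _ _ ?_
        intro l' hl'
        by_cases hlen : l'.length = 1
        · obtain ⟨y, rfl⟩ := List.length_eq_one_iff.1 hlen
          exact hv y (hl' y (by simp))
        · exact hs _ hlen
      rw [Pi.smul_apply, Pi.smul_apply, h5, smul_zero, add_zero, smul_eq_mul] at h4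
      rcases mul_eq_zero.1 h4 with h | h
      · exact absurd h hx
      · exact h
    · exact pw_sup hΩ h1 k l hl

end Om

end ListAlg

/-- An alternating map as a function of lists. -/
noncomputable def toL {p : ℕ} (α : V [⋀^Fin p]→ₗ[ℝ] ℝ) : List V → ℝ := fun l =>
  if h : l.length = p then α (fun i => l.get (i.cast h.symm)) else 0

theorem toL_sup {p : ℕ} (α : V [⋀^Fin p]→ₗ[ℝ] ℝ) : Sup p (toL α) :=
  fun l hl => by simp [toL, hl]

theorem toL_ofFn {p : ℕ} (α : V [⋀^Fin p]→ₗ[ℝ] ℝ) (v : Fin p → V) :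
    toL α (List.ofFn v) = α v := by
  simp [toL]

theorem toL_inj {p : ℕ} {α β : V [⋀^Fin p]→ₗ[ℝ] ℝ} (h : toL α = toL β) : α = β := by
  ext v
  rw [← toL_ofFn, ← toL_ofFn, h]

theorem io_toL {p : ℕ} (α : V [⋀^Fin (p + 1)]→ₗ[ℝ] ℝ) (v : V) :
    io v (toL α) = toL (α.curryLeft v) := by
  funext l
  by_cases hl : l.length = p
  · subst hl
    simp only [io, toL, List.length_cons, dif_pos, AlternatingMap.curryLeft_apply_apply]
    congr 1
    funext i
    refine Fin.cases ?_ (fun i => ?_) i <;> rfl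
  · simp [io, toL, hl]

theorem toL_congr {p q : ℕ} (h : p = q) (α : V [⋀^Fin p]→ₗ[ℝ] ℝ) :
    toL (α.domDomCongr (finCongr h)) = toL α := by
  subst h
  rfl

theorem mu_toL_T (l : List V) : ∀ {p q : ℕ} (h : p + q = l.length) (α : V [⋀^Fin p]→ₗ[ℝ] ℝ)
    (β : V [⋀^Fin q]→ₗ[ℝ] ℝ),
    (p.factorial * q.factorial : ℝ) * mu (toL α) (toL β) l = T h α β l.get := by
  induction l with
  | nil =>
    intro p q h α β
    obtain ⟨rfl, rfl⟩ : p = 0 ∧ q = 0 := by simpa using h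
    rw [mu_nil]
    simp only [T, G, toL]
    rw [Fintype.sum_eq_single 1]
    · simp
    · intro x hx
      exact absurd (Equiv.ext fun i => absurd i.2 (by simp)) hx
  | cons v l ih =>
    intro p q h α β
    have hget : (v :: l).get = (Fin.cons v l.get : Fin (l.length + 1) → V) := by
      funext i
      refine Fin.cases ?_ (fun i => ?_) i <;> rfl
    have h' : p + q = l.length + 1 := h
    have e : T h α β (v :: l).get = T h' α β (Fin.cons v l.get : Fin (l.length + 1) → V) := by
      rw [hget]
    rw [e, T_succ, sum_split h', mu_cons, mul_add]
    congr 1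
    · cases p with
      | zero =>
        rw [(toL_sup α).io_zero, mu_zero_left]
        simp
      | succ p =>
        have hh := left_part h' α β v l.get
        refine Eq.trans ?_ hh.symm
        rw [← ih, io_toL, Nat.factorial_succ]
        push_cast
        ring
    · cases q with
      | zero =>
        rw [(toL_sup β).io_zero, mu_zero_right]
        simp
      | succ q =>
        have hh := right_part h' α β v l.get
        refine Eq.trans ?_ hh.symm
        rw [← ih, io_toL, Nat.factorial_succ, (toL_sup α).tw, mu_smul_left, Pi.smul_apply,
          smul_eq_mul]
        push_cast
        ring

theorem toL_wedge {p q : ℕ} (α : V [⋀^Fin p]→ₗ[ℝ] ℝ) (β : V [⋀^Fin q]→ₗ[ℝ] ℝ) :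
    toL (wedge α β) = mu (toL α) (toL β) := by
  funext l
  by_cases hl : p + q = l.length
  · have h1 := mu_toL_T l hl α β
    have h2 := wedge_T α β (fun i => l.get (i.cast hl))
    have h3 : toL (wedge α β) l = wedge α β (fun i => l.get (i.cast hl)) := by
      simp [toL, hl]
    have h4 : ∀ (N : ℕ) (h : p + q = N) (u : Fin N → V),
        T rfl α β (fun i => u (i.cast h)) = T h α β u := by
      intro N h u
      subst h
      rfl
    rw [h4, ← h1, ← h3] at h2
    exact mul_left_cancel₀ (by positivity) h2
  · rw [toL_sup _ _ (Ne.symm hl), ((toL_sup α).mu (toL_sup β)) _ (Ne.symm hl)]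

theorem toL_wpowA (Ω : V [⋀^Fin 2]→ₗ[ℝ] ℝ) (j : ℕ) :
    toL (wpowA Ω j) =
      pw (toL Ω) (toL (AlternatingMap.constOfIsEmpty ℝ V (Fin 0) (1 : ℝ))) j := by
  induction j with
  | zero => exact toL_congr _ _
  | succ j ih =>
    unfold wpowA
    rw [toL_congr, toL_wedge, ih]
    rfl

theorem finrank_alt (m k : ℕ) :
    Module.finrank ℝ ((Fin m → ℝ) [⋀^Fin k]→ₗ[ℝ] ℝ) = m.choose k := by
  rw [(exteriorPower.alternatingMapLinearEquiv (R := ℝ) (M := Fin m → ℝ) (N := ℝ)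
    (n := k)).finrank_eq]
  have := Subspace.dual_finrank_eq (K := ℝ) (V := ⋀[ℝ]^k (Fin m → ℝ))
  refine Eq.trans this ?_
  rw [exteriorPower.finrank_eq, Module.finrank_fin_fun]

theorem finite_alt (m k : ℕ) : Module.Finite ℝ ((Fin m → ℝ) [⋀^Fin k]→ₗ[ℝ] ℝ) :=
  Module.Finite.equiv (exteriorPower.alternatingMapLinearEquiv (R := ℝ) (M := Fin m → ℝ)
    (N := ℝ) (n := k)).symm

theorem exists_kill (n : ℕ) (Ω : (Fin (2 * n) → ℝ) [⋀^Fin 2]→ₗ[ℝ] ℝ)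
    (hnd : ∀ v : Fin (2 * n) → ℝ, v ≠ 0 → ∃ w, Ω ![v, w] ≠ 0)
    (l : List (Fin (2 * n) → ℝ)) (hl : l.length < 2 * n) :
    ∃ v x, (∀ y ∈ l, toL Ω [v, y] = 0) ∧ toL Ω [v, x] ≠ 0 := by
  have e : ∀ v y, toL Ω [v, y] = Ω ![v, y] := by
    intro v y
    have := toL_ofFn Ω ![v, y]
    simpa using this
  let φ : (Fin (2 * n) → ℝ) →ₗ[ℝ] (Fin l.length → ℝ) :=
    LinearMap.pi fun i =>
      { toFun := fun v => Ω ![v, l.get i]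
        map_add' := fun a b => Ω.map_vecCons_add _ _ _
        map_smul' := fun c a => Ω.map_vecCons_smul _ _ _ }
  obtain ⟨v, hv, hv0⟩ := (Submodule.ne_bot_iff _).1
    (LinearMap.ker_ne_bot_of_finrank_lt (f := φ) (by simpa using hl))
  obtain ⟨x, hx⟩ := hnd v hv0
  refine ⟨v, x, ?_, by rwa [e]⟩
  intro y hy
  obtain ⟨i, rfl⟩ := List.get_of_mem hy
  rw [e]
  exact congrFun (LinearMap.mem_ker.1 hv) i

/-- Lepage's divisibility theorem: for a non-degenerate
2-form `Ω` on `ℝ^{2n}` and `0 ≤ p < n`, the map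
`η ↦ η ∧ Ω^{n-p} : Λ^p(ℝ^{2n})* → Λ^{2n-p}(ℝ^{2n})*` is a linear bijection. -/
theorem stmt7 (n p : ℕ) (hp : p < n)
    (Ω : (Fin (2 * n) → ℝ) [⋀^Fin 2]→ₗ[ℝ] ℝ)
    (hnd : ∀ v : Fin (2 * n) → ℝ, v ≠ 0 → ∃ w, Ω ![v, w] ≠ 0) :
    Function.Bijective (fun η : (Fin (2 * n) → ℝ) [⋀^Fin p]→ₗ[ℝ] ℝ =>
      ((wedge η (wpowA Ω (n - p))).domDomCongr
        (finCongr (show p + 2 * (n - p) = 2 * n - p by omega)) :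
        (Fin (2 * n) → ℝ) [⋀^Fin (2 * n - p)]→ₗ[ℝ] ℝ)) := by
  have hinj : ∀ η : (Fin (2 * n) → ℝ) [⋀^Fin p]→ₗ[ℝ] ℝ,
      wedge η (wpowA Ω (n - p)) = 0 → η = 0 := by
    intro η h0
    have h1 := congrArg toL h0
    have hz : ∀ k : ℕ, toL (0 : (Fin (2 * n) → ℝ) [⋀^Fin k]→ₗ[ℝ] ℝ) = 0 := by
      intro k; funext l; simp [toL]
    rw [toL_wedge, toL_wpowA, hz] at h1
    have h2 := lepage_inj (toL_sup Ω) (toL_sup _) n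
      (pw_step (toL_sup Ω) (toL_sup _) n (exists_kill n Ω hnd) (by simp [toL]) n le_rfl)
      p (n - p) (by omega) (toL η) (toL_sup η) h1
    exact toL_inj (h2.trans (hz p).symm)
  have := finite_alt (2 * n) p
  have := finite_alt (2 * n) (2 * n - p)
  let L : ((Fin (2 * n) → ℝ) [⋀^Fin p]→ₗ[ℝ] ℝ) →ₗ[ℝ]
      ((Fin (2 * n) → ℝ) [⋀^Fin (2 * n - p)]→ₗ[ℝ] ℝ) :=
    { toFun := fun η => (wedge η (wpowA Ω (n - p))).domDomCongr
        (finCongr (show p + 2 * (n - p) = 2 * n - p by omega))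
      map_add' := by
        intro a b
        apply toL_inj
        have hadd : ∀ {k : ℕ} (x y : (Fin (2 * n) → ℝ) [⋀^Fin k]→ₗ[ℝ] ℝ),
            toL (x + y) = toL x + toL y := by
          intro k x y; funext l; simp only [toL, Pi.add_apply]; split_ifs <;> simp
        rw [hadd, toL_congr, toL_congr, toL_congr, toL_wedge, toL_wedge, toL_wedge, hadd,
          mu_add_left]
      map_smul' := by
        intro c a
        apply toL_inj
        have hsm : ∀ {k : ℕ} (x : (Fin (2 * n) → ℝ) [⋀^Fin k]→ₗ[ℝ] ℝ),
            toL (c • x) = c • toL x := by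
          intro k x; funext l; simp only [toL, Pi.smul_apply]; split_ifs <;> simp
        rw [RingHom.id_apply, hsm, toL_congr, toL_congr, toL_wedge, toL_wedge, hsm,
          mu_smul_left] }
  have hL : Function.Injective L := by
    rw [← LinearMap.ker_eq_bot, LinearMap.ker_eq_bot']
    intro η h
    apply hinj
    have h' : (wedge η (wpowA Ω (n - p))).domDomCongr
        (finCongr (show p + 2 * (n - p) = 2 * n - p by omega)) = 0 := h
    exact (AlternatingMap.domDomCongr_eq_zero_iff _ _).1 h'
  have hd : Module.finrank ℝ ((Fin (2 * n) → ℝ) [⋀^Fin p]→ₗ[ℝ] ℝ) =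
      Module.finrank ℝ ((Fin (2 * n) → ℝ) [⋀^Fin (2 * n - p)]→ₗ[ℝ] ℝ) := by
    rw [finrank_alt, finrank_alt, Nat.choose_symm (by omega)]
  exact ⟨hL, (LinearMap.injective_iff_surjective_of_finrank_eq_finrank hd).1 hL⟩

end Stmt7
end
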